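/- Let $r\geq t>0$, $\alpha\in(0,1)$, and let $v\in C(B_{r+t}(0))$ with $B_{r+t}(0)\subset\mathbb{R}^n$ satisfy, for some constant $A\geq 0$, $\left|\;\fint_{\partial B_h(0)}v(x+y)\,d\sigma_y-v(x)\right|\leq A\,h^{1+\alpha}$ for all $x\in B_r(0)$ and $h\in(0,t]$. Let $\rho$ be a smooth, nonnegative, radially symmetric function on $\mathbb{R}^n$ with support in the closed unit ball and total integral $1$, set $\rho_h(x)=h^{-n}\rho(x/h)$ and $v_h=\rho_h * v$. Then there is a constant $C$ depending only on $n$ and $\rho$ such that for all $h\in(0,t]$ and all $x\in B_r(0)$: $|\Delta v_h(x)|\leq C\,A\,h^{\alpha-1}$. -/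

import Mathlib

open Metric Set MeasureTheory

/-- The average of `y ↦ v (x + y)` over the sphere `{y : ‖y‖ = h}` in `ℝⁿ`,
with respect to the `(n-1)`-dimensional Hausdorff (surface) measure. -/
noncomputable def sphereAvg (n : ℕ) (v : EuclideanSpace ℝ (Fin n) → ℝ)
    (x : EuclideanSpace ℝ (Fin n)) (h : ℝ) : ℝ :=
  ⨍ y in sphere (0 : EuclideanSpace ℝ (Fin n)) h, v (x + y) ∂(μH[(n : ℝ) - 1])

/-- The mollification `v_h = ρ_h * v`, where `ρ_h(x) = h⁻ⁿ ρ(x/h)`: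
`v_h(x) = ∫ ρ_h(y) v(x - y) dy`. -/
noncomputable def moll (n : ℕ) (ρ v : EuclideanSpace ℝ (Fin n) → ℝ) (h : ℝ)
    (x : EuclideanSpace ℝ (Fin n)) : ℝ :=
  ∫ y : EuclideanSpace ℝ (Fin n), ((h ^ n)⁻¹ * ρ (h⁻¹ • y)) * v (x - y)

/-- The Laplacian of `u : ℝⁿ → ℝ`, as the sum of the second derivatives
in the coordinate directions, computed via real Fréchet derivatives. -/
noncomputable def lapl (n : ℕ) (u : EuclideanSpace ℝ (Fin n) → ℝ)
    (x : EuclideanSpace ℝ (Fin n)) : ℝ :=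
  ∑ i : Fin n,
    (fderiv ℝ (fun w => fderiv ℝ u w (EuclideanSpace.single i (1 : ℝ))) x)
      (EuclideanSpace.single i (1 : ℝ))

/-- The radial projection onto the sphere of radius `s` of the face of the cube whose
`i`-th coordinate is `c`. -/
noncomputable def cubeFaceToSphere {m : ℕ} (s : ℝ) (i : Fin (m + 1)) (c : ℝ) (z : Fin m → ℝ) :
    EuclideanSpace ℝ (Fin (m + 1)) :=
  (s / ‖WithLp.toLp 2 (i.insertNth (α := fun _ => ℝ) c z)‖) •
    WithLp.toLp 2 (i.insertNth (α := fun _ => ℝ) c z)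

lemma contDiff_cubeFaceToSphere {m : ℕ} (s : ℝ) (i : Fin (m + 1)) {c : ℝ} (hc : c ≠ 0) :
    ContDiff ℝ 1 (cubeFaceToSphere s i c) := by
  have h : ContDiff ℝ 1 (fun z : Fin m → ℝ =>
      (WithLp.toLp 2 (i.insertNth (α := fun _ => ℝ) c z) : EuclideanSpace ℝ (Fin (m + 1)))) := by
    rw [contDiff_euclidean]
    intro j
    refine Fin.succAboveCases i ?_ (fun k => ?_) j
    · simpa using contDiff_const
    · simpa using contDiff_apply ℝ ℝ k
  have h0 (z : Fin m → ℝ) :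
      (WithLp.toLp 2 (i.insertNth (α := fun _ => ℝ) c z) : EuclideanSpace ℝ (Fin (m + 1))) ≠ 0 := by
    intro hz
    apply hc
    simpa using congrArg (fun y : EuclideanSpace ℝ (Fin (m + 1)) => y i) hz
  exact (contDiff_const.div (h.norm ℝ h0) (fun z => norm_ne_zero_iff.2 (h0 z))).smul h

lemma sphere_subset_iUnion_cubeFaceToSphere {m : ℕ} {s : ℝ} (hs : 0 < s) :
    sphere (0 : EuclideanSpace ℝ (Fin (m + 1))) s ⊆
      ⋃ i : Fin (m + 1), ⋃ c ∈ ({1, -1} : Set ℝ), cubeFaceToSphere s i c '' closedBall 0 1 := by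
  intro y hy
  have hys : ‖y‖ = s := by simpa using hy
  obtain ⟨i, hi⟩ := Finite.exists_max (fun i => |y i|)
  have hpos : 0 < |y i| := by
    by_contra! h
    have : y = 0 := by
      ext j
      exact abs_nonpos_iff.1 ((hi j).trans h)
    rw [this, norm_zero] at hys
    exact hs.ne hys
  have hvec : WithLp.toLp 2 (i.insertNth (α := fun _ => ℝ) (y i / |y i|)
      (fun j => y (i.succAbove j) / |y i|)) = |y i|⁻¹ • y := by
    ext j
    refine Fin.succAboveCases i ?_ (fun k => ?_) j <;> simp [div_eq_inv_mul]
  simp only [mem_iUnion]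
  refine ⟨i, y i / |y i|, ?_, fun j => y (i.succAbove j) / |y i|, ?_, ?_⟩
  · rcases abs_cases (y i) with ⟨h, _⟩ | ⟨h, _⟩
    · left
      rw [h] at hpos ⊢
      exact div_self hpos.ne'
    · right
      rw [h] at hpos ⊢
      rw [mem_singleton_iff, div_neg, div_self]
      linarith
  · rw [mem_closedBall_zero_iff, pi_norm_le_iff_of_nonneg zero_le_one]
    intro j
    rw [Real.norm_eq_abs, abs_div, abs_abs, div_le_one hpos]
    exact hi _
  · rw [cubeFaceToSphere, hvec, norm_smul, norm_inv, Real.norm_eq_abs, abs_abs, smul_smul, hys,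
      show s / (|y i|⁻¹ * s) * |y i|⁻¹ = 1 by field_simp, one_smul]

lemma hausdorffMeasure_sphere_lt_top (m : ℕ) {s : ℝ} (hs : 0 < s) :
    μH[(m : ℝ)] (sphere (0 : EuclideanSpace ℝ (Fin (m + 1))) s) < ⊤ := by
  refine (measure_mono (sphere_subset_iUnion_cubeFaceToSphere hs)).trans_lt ?_
  refine (measure_iUnion_fintype_le _ _).trans_lt (ENNReal.sum_lt_top.2 fun i _ => ?_)
  refine measure_biUnion_lt_top (by simp) fun c hc => ?_
  have hc0 : c ≠ 0 := by rcases hc with rfl | rfl <;> norm_num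
  obtain ⟨K, hK⟩ := (contDiff_cubeFaceToSphere s i hc0).contDiffOn.exists_lipschitzOnWith
    one_ne_zero (convex_closedBall 0 1) (isCompact_closedBall (0 : Fin m → ℝ) 1)
  refine (hK.hausdorffMeasure_image_le m.cast_nonneg).trans_lt ?_
  have h : (μH[(m : ℝ)] : Measure (Fin m → ℝ)) = volume := by
    simpa using hausdorffMeasure_pi_real (ι := Fin m)
  rw [h]
  exact ENNReal.mul_lt_top (by simp) measure_closedBall_lt_top

lemma hausdorffMeasure_sphere_pos (m : ℕ) {s : ℝ} (hs : 0 < s) :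
    0 < μH[(m : ℝ)] (sphere (0 : EuclideanSpace ℝ (Fin (m + 1))) s) := by
  let p : EuclideanSpace ℝ (Fin (m + 1)) → (Fin m → ℝ) := fun y j => y j.succ
  have hp : LipschitzWith 1 p := by
    refine LipschitzWith.of_dist_le_mul fun y z => ?_
    rw [NNReal.coe_one, one_mul, dist_pi_le_iff dist_nonneg]
    intro j
    rw [dist_eq_norm, dist_eq_norm]
    exact PiLp.norm_apply_le (y - z) j.succ
  let U : Set (Fin m → ℝ) := {z | ∑ j, z j ^ 2 < s ^ 2}
  have hU : IsOpen U := isOpen_lt (by fun_prop) continuous_const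
  have hUp : U ⊆ p '' sphere 0 s := by
    intro z hz
    refine ⟨WithLp.toLp 2 (Fin.cons (√(s ^ 2 - ∑ j, z j ^ 2)) z), ?_, ?_⟩
    · rw [mem_sphere_zero_iff_norm, EuclideanSpace.norm_eq, Fin.sum_univ_succ]
      simp only [Fin.cons_zero, Fin.cons_succ, Real.norm_eq_abs, sq_abs]
      rw [Real.sq_sqrt (sub_nonneg.2 (le_of_lt hz)), sub_add_cancel, Real.sqrt_sq hs.le]
    · ext j
      simp [p]
  have h : (μH[(m : ℝ)] : Measure (Fin m → ℝ)) = volume := by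
    simpa using hausdorffMeasure_pi_real (ι := Fin m)
  have hle := hp.hausdorffMeasure_image_le (d := m) m.cast_nonneg
    (sphere (0 : EuclideanSpace ℝ (Fin (m + 1))) s)
  simp only [ENNReal.coe_one, ENNReal.one_rpow, one_mul] at hle
  refine lt_of_lt_of_le ?_ ((measure_mono hUp).trans hle)
  rw [h]
  exact hU.measure_pos volume ⟨0, by simpa [U] using pow_pos hs 2⟩


section
variable {E : Type*} [NormedAddCommGroup E] [InnerProductSpace ℝ E] [FiniteDimensional ℝ E]

instance compactSpace_unitary_continuousLinearMap : CompactSpace (unitary (E →L[ℝ] E)) := by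
  have : ProperSpace (E →L[ℝ] E) := FiniteDimensional.proper_real _
  refine isCompact_iff_compactSpace.1 (Metric.isCompact_of_isClosed_isBounded isClosed_unitary ?_)
  refine (isBounded_iff_forall_norm_le).2 ⟨1, fun g hg => ?_⟩
  refine ContinuousLinearMap.opNorm_le_bound _ zero_le_one fun x => ?_
  rw [one_mul]
  exact ((Unitary.linearIsometryEquiv ⟨g, hg⟩).norm_map x).le

/-- The mean of `w` over the orbit of `y` under the orthogonal group. -/
noncomputable def rotAvg (w : E → ℝ) (y : E) : ℝ :=
  ∫ g : unitary (E →L[ℝ] E), w (Unitary.linearIsometryEquiv g⁻¹ y)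
    ∂(Measure.haarMeasure ⊤)

lemma exists_unitary_apply_eq {y z : E} (h : ‖y‖ = ‖z‖) :
    ∃ k : unitary (E →L[ℝ] E), Unitary.linearIsometryEquiv k y = z :=
  ⟨Unitary.linearIsometryEquiv.symm (Submodule.reflection (Submodule.span ℝ {y - z})ᗮ), by
    simpa using Submodule.reflection_sub h⟩

lemma rotAvg_eq_of_norm_eq (w : E → ℝ) {y z : E} (h : ‖y‖ = ‖z‖) : rotAvg w y = rotAvg w z := by
  obtain ⟨k, rfl⟩ := exists_unitary_apply_eq h
  rw [rotAvg, rotAvg, ← integral_mul_left_eq_self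
    (fun g => w (Unitary.linearIsometryEquiv g⁻¹ (Unitary.linearIsometryEquiv k y))) k]
  simp [map_mul]

lemma haarMeasure_top_real_univ :
    (Measure.haarMeasure (⊤ : TopologicalSpace.PositiveCompacts
      (unitary (E →L[ℝ] E)))).real univ = 1 := by
  rw [measureReal_def, ← TopologicalSpace.PositiveCompacts.coe_top, Measure.haarMeasure_self]
  simp

lemma rotAvg_const (c : ℝ) (y : E) : rotAvg (fun _ : E => c) y = c := by
  simp [rotAvg, haarMeasure_top_real_univ]

lemma rotAvg_zero (w : E → ℝ) : rotAvg w 0 = w 0 := by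
  simp [rotAvg, haarMeasure_top_real_univ]

lemma continuous_unitary_inv_apply :
    Continuous fun p : E × unitary (E →L[ℝ] E) => Unitary.linearIsometryEquiv p.2⁻¹ p.1 := by
  have : Continuous fun p : E × unitary (E →L[ℝ] E) =>
      ((p.2⁻¹ : unitary (E →L[ℝ] E)) : E →L[ℝ] E) p.1 := by
    fun_prop
  exact this

lemma hasCompactSupport_comp_unitary_inv_apply {w : E → ℝ} (hw : HasCompactSupport w) :
    HasCompactSupport
      fun p : E × unitary (E →L[ℝ] E) => w (Unitary.linearIsometryEquiv p.2⁻¹ p.1) := by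
  have : ProperSpace E := FiniteDimensional.proper_real _
  obtain ⟨R, hR⟩ := hw.isBounded.subset_closedBall 0
  refine HasCompactSupport.intro ((isCompact_closedBall (0 : E) R).prod isCompact_univ) ?_
  rintro ⟨y, g⟩ hy
  by_contra h
  apply hy
  have := hR (subset_tsupport _ h)
  simpa using this

lemma rotAvg_mul_of_radial {ψ : E → ℝ} (hψ : ∀ y z, ‖y‖ = ‖z‖ → ψ y = ψ z) (w : E → ℝ) (y : E) :
    rotAvg (fun y => ψ y * w y) y = ψ y * rotAvg w y := by
  simp only [rotAvg]
  rw [← integral_const_mul]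
  congr 1 with g
  rw [hψ (Unitary.linearIsometryEquiv g⁻¹ y) y (by simp)]

variable [MeasurableSpace E] [BorelSpace E]

/-- A measure invariant under linear isometries does not distinguish a function from its rotational
average. -/
lemma integral_rotAvg {w : E → ℝ} (hwc : Continuous w) (hw : HasCompactSupport w)
    {μ : Measure E} [IsFiniteMeasureOnCompacts μ]
    (hμ : ∀ g : E ≃ₗᵢ[ℝ] E, MeasurePreserving g μ μ) :
    ∫ y, rotAvg w y ∂μ = ∫ y, w y ∂μ := by
  have h2 (g : unitary (E →L[ℝ] E)) :
      ∫ y, w (Unitary.linearIsometryEquiv g⁻¹ y) ∂μ = ∫ y, w y ∂μ :=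
    (hμ _).integral_comp (Unitary.linearIsometryEquiv g⁻¹).toHomeomorph.measurableEmbedding w
  let f : E → unitary (E →L[ℝ] E) → ℝ := fun y g => w (Unitary.linearIsometryEquiv g⁻¹ y)
  have hf : Continuous f.uncurry := hwc.comp continuous_unitary_inv_apply
  have hf' : HasCompactSupport f.uncurry := hasCompactSupport_comp_unitary_inv_apply hw
  refine (integral_integral_swap_of_hasCompactSupport hf hf').trans ?_
  simp only [f, h2, integral_const, haarMeasure_top_real_univ, one_smul]

lemma setAverage_sphere_eq_rotAvg {w : E → ℝ} (hwc : Continuous w) (hw : HasCompactSupport w)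
    {μ : Measure E} (hμ : ∀ g : E ≃ₗᵢ[ℝ] E, MeasurePreserving g μ μ) (y : E)
    (h0 : μ (sphere 0 ‖y‖) ≠ 0) (htop : μ (sphere 0 ‖y‖) ≠ ⊤) :
    ⨍ z in sphere 0 ‖y‖, w z ∂μ = rotAvg w y := by
  have : IsFiniteMeasure (μ.restrict (sphere 0 ‖y‖)) := isFiniteMeasure_restrict.2 htop
  have hres (g : E ≃ₗᵢ[ℝ] E) : MeasurePreserving g (μ.restrict (sphere 0 ‖y‖))
      (μ.restrict (sphere 0 ‖y‖)) := by
    have h := (hμ g).restrict_preimage (isClosed_sphere (x := (0 : E)) (ε := ‖y‖)).measurableSet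
    simpa using h
  have hconst : ∫ z in sphere 0 ‖y‖, rotAvg w z ∂μ = ∫ z in sphere 0 ‖y‖, rotAvg w y ∂μ :=
    setIntegral_congr_fun isClosed_sphere.measurableSet fun z hz =>
      rotAvg_eq_of_norm_eq w (by simpa using hz)
  rw [integral_rotAvg hwc hw hres, setIntegral_const] at hconst
  rw [setAverage_eq, hconst, smul_smul, inv_mul_cancel₀, one_smul]
  exact (measureReal_ne_zero_iff htop).2 h0

end


section
variable {n : ℕ}

lemma lapl_congr {u v : EuclideanSpace ℝ (Fin n) → ℝ} {x : EuclideanSpace ℝ (Fin n)}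
    (h : u =ᶠ[nhds x] v) : lapl n u x = lapl n v x := by
  refine Finset.sum_congr rfl fun i _ => ?_
  have : (fun w => fderiv ℝ u w (EuclideanSpace.single i (1 : ℝ))) =ᶠ[nhds x]
      fun w => fderiv ℝ v w (EuclideanSpace.single i (1 : ℝ)) :=
    (h.fderiv (𝕜 := ℝ)).mono fun w hw => by simp only [hw]
  rw [this.fderiv_eq]

lemma lapl_eq_zero_of_notMem_tsupport {u : EuclideanSpace ℝ (Fin n) → ℝ}
    {x : EuclideanSpace ℝ (Fin n)} (h : x ∉ tsupport u) : lapl n u x = 0 := by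
  rw [lapl_congr (notMem_tsupport_iff_eventuallyEq.1 h)]
  simp [lapl]

lemma ContDiff.lapl_eq_laplacian {u : EuclideanSpace ℝ (Fin n) → ℝ} (hu : ContDiff ℝ 2 u) :
    lapl n u = Laplacian.laplacian u := by
  rw [InnerProductSpace.laplacian_eq_iteratedFDeriv_orthonormalBasis u
    (EuclideanSpace.basisFun (Fin n) ℝ)]
  ext x
  refine Finset.sum_congr rfl fun i _ => ?_
  have : DifferentiableAt ℝ (fderiv ℝ u) x :=
    (hu.fderiv_right (m := 1) (by norm_num)).differentiable one_ne_zero x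
  rw [iteratedFDeriv_two_apply, fderiv_clm_apply this (differentiableAt_const _)]
  simp

lemma laplacian_comp_linearIsometryEquiv {E F : Type*} [NormedAddCommGroup E]
    [InnerProductSpace ℝ E] [FiniteDimensional ℝ E] [NormedAddCommGroup F] [NormedSpace ℝ F]
    {u : E → F} (g : E ≃ₗᵢ[ℝ] E) (hu : ContDiff ℝ 2 u) (x : E) :
    Laplacian.laplacian (u ∘ g) x = Laplacian.laplacian u (g x) := by
  rw [InnerProductSpace.laplacian_eq_iteratedFDeriv_orthonormalBasis (u ∘ g)
    (stdOrthonormalBasis ℝ E), InnerProductSpace.laplacian_eq_iteratedFDeriv_orthonormalBasis u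
    ((stdOrthonormalBasis ℝ E).map g)]
  refine Finset.sum_congr rfl fun i _ => ?_
  have h := (g : E →L[ℝ] E).iteratedFDeriv_comp_right hu x (i := 2) le_rfl
  have h' : u ∘ (g : E →L[ℝ] E) = u ∘ g := rfl
  rw [← h', h, ContinuousMultilinearMap.compContinuousLinearMap_apply]
  congr 1
  ext j
  fin_cases j <;> simp

lemma ContDiff.lapl_radial {ρ : EuclideanSpace ℝ (Fin n) → ℝ} (hρ : ContDiff ℝ 2 ρ)
    (hrad : ∀ x y, ‖x‖ = ‖y‖ → ρ x = ρ y) {x y : EuclideanSpace ℝ (Fin n)} (h : ‖x‖ = ‖y‖) :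
    lapl n ρ x = lapl n ρ y := by
  let g := Submodule.reflection (Submodule.span ℝ {x - y})ᗮ
  have hg : g x = y := Submodule.reflection_sub h
  have hcomp : ρ ∘ g = ρ := funext fun z => hrad _ _ (by simp)
  rw [hρ.lapl_eq_laplacian, ← hg, ← laplacian_comp_linearIsometryEquiv g hρ, hcomp]

lemma ContDiff.continuous_lapl {u : EuclideanSpace ℝ (Fin n) → ℝ} (hu : ContDiff ℝ 2 u) :
    Continuous (lapl n u) := by
  unfold lapl
  refine continuous_finsetSum _ fun i _ => ?_
  have h1 : ContDiff ℝ 1 (fun w => fderiv ℝ u w (EuclideanSpace.single i (1 : ℝ))) :=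
    (hu.fderiv_right (m := 1) (by norm_num)).clm_apply contDiff_const
  exact (h1.continuous_fderiv one_ne_zero).clm_apply continuous_const

lemma lapl_const_mul_comp_smul (u : EuclideanSpace ℝ (Fin n) → ℝ) (hu : ContDiff ℝ 2 u) (a c : ℝ)
    (x : EuclideanSpace ℝ (Fin n)) :
    lapl n (fun y => a * u (c • y)) x = a * c ^ 2 * lapl n u (c • x) := by
  have key (w : EuclideanSpace ℝ (Fin n) → ℝ) (hw : Differentiable ℝ w) (b : ℝ)
      (y : EuclideanSpace ℝ (Fin n)) :
      fderiv ℝ (fun y => b * w (c • y)) y = (b * c) • fderiv ℝ w (c • y) := by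
    rw [fderiv_const_mul (by fun_prop), fderiv_comp_smul, smul_smul]
  unfold lapl
  rw [Finset.mul_sum]
  refine Finset.sum_congr rfl fun i _ => ?_
  have h1 : ContDiff ℝ 1 (fun w => fderiv ℝ u w (EuclideanSpace.single i (1 : ℝ))) :=
    (hu.fderiv_right (m := 1) (by norm_num)).clm_apply contDiff_const
  have h2 := key _ (h1.differentiable one_ne_zero) (a * c) x
  simp only [key u (hu.differentiable two_ne_zero), smul_apply, smul_eq_mul]
  rw [h2]
  simp only [smul_apply, smul_eq_mul]
  ring

open scoped Convolution in
lemma fderiv_convolution_mul_apply {φ v : EuclideanSpace ℝ (Fin n) → ℝ}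
    (hφ : ContDiff ℝ 1 φ) (hφc : HasCompactSupport φ) (hv : LocallyIntegrable v)
    (e x : EuclideanSpace ℝ (Fin n)) :
    fderiv ℝ (fun x => ∫ y, φ y * v (x - y)) x e = ∫ y, fderiv ℝ φ y e * v (x - y) := by
  have h := hφc.hasFDerivAt_convolution_left (ContinuousLinearMap.mul ℝ ℝ) hφ hv x
  have hint := (hφc.fderiv ℝ).convolutionExists_left
    ((ContinuousLinearMap.mul ℝ ℝ).precompL (EuclideanSpace ℝ (Fin n)))
    (hφ.continuous_fderiv one_ne_zero) hv x
  have h' : fderiv ℝ (fun x => ∫ y, φ y * v (x - y)) x = _ := h.fderiv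
  rw [h', convolution_def, ContinuousLinearMap.integral_apply hint]
  rfl

lemma lapl_convolution_mul {φ v : EuclideanSpace ℝ (Fin n) → ℝ}
    (hφ : ContDiff ℝ 2 φ) (hφc : HasCompactSupport φ) (hv : LocallyIntegrable v)
    (x : EuclideanSpace ℝ (Fin n)) :
    lapl n (fun x => ∫ y, φ y * v (x - y)) x = ∫ y, lapl n φ y * v (x - y) := by
  have h1 (i : Fin n) :
      ContDiff ℝ 1 (fun w => fderiv ℝ φ w (EuclideanSpace.single i (1 : ℝ))) :=
    (hφ.fderiv_right (m := 1) (by norm_num)).clm_apply contDiff_const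
  have hc1 (i : Fin n) :
      HasCompactSupport (fun w => fderiv ℝ φ w (EuclideanSpace.single i (1 : ℝ))) :=
    hφc.fderiv_apply ℝ _
  have hint (i : Fin n) : Integrable fun y =>
      fderiv ℝ (fun w => fderiv ℝ φ w (EuclideanSpace.single i (1 : ℝ))) y
        (EuclideanSpace.single i (1 : ℝ)) * v (x - y) :=
    ((hc1 i).fderiv_apply ℝ _).convolutionExists_left (ContinuousLinearMap.mul ℝ ℝ)
      (((h1 i).continuous_fderiv one_ne_zero).clm_apply continuous_const) hv x
  simp only [lapl, Finset.sum_mul]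
  rw [integral_finsetSum _ fun i _ => hint i]
  refine Finset.sum_congr rfl fun i _ => ?_
  simp_rw [fderiv_convolution_mul_apply (hφ.of_le one_le_two) hφc hv]
  exact fderiv_convolution_mul_apply (h1 i) (hc1 i) hv _ x

lemma integral_lapl_eq_zero {φ : EuclideanSpace ℝ (Fin n) → ℝ}
    (hφ : ContDiff ℝ 2 φ) (hφc : HasCompactSupport φ) : ∫ y, lapl n φ y = 0 := by
  have h := lapl_convolution_mul hφ hφc
    (v := fun _ => 1) continuous_const.locallyIntegrable (0 : EuclideanSpace ℝ (Fin n))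
  simpa [lapl] using h.symm

end


section
variable {n : ℕ}

lemma rotAvg_sub_const {E : Type*} [NormedAddCommGroup E] [InnerProductSpace ℝ E]
    [FiniteDimensional ℝ E] {w : E → ℝ} (hw : Continuous w) (c : ℝ) (y : E) :
    rotAvg (fun z => w z - c) y = rotAvg w y - c := by
  have hcont : Continuous fun g : unitary (E →L[ℝ] E) => w (Unitary.linearIsometryEquiv g⁻¹ y) := by
    have h := (continuous_unitary_inv_apply (E := E)).comp (Continuous.prodMk_right y)
    exact hw.comp h
  conv_rhs => rw [← rotAvg_const c y]
  exact integral_sub (hcont.integrable_of_hasCompactSupport (HasCompactSupport.of_compactSpace _))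
    (integrable_const c)

lemma sphereAvg_norm_eq_rotAvg {m : ℕ} {v : EuclideanSpace ℝ (Fin (m + 1)) → ℝ}
    (hv : Continuous v) (hvc : HasCompactSupport v) (x : EuclideanSpace ℝ (Fin (m + 1)))
    {y : EuclideanSpace ℝ (Fin (m + 1))} (hy : y ≠ 0) :
    sphereAvg (m + 1) v x ‖y‖ = rotAvg (fun z => v (x + z)) y := by
  have hd : ((m + 1 : ℕ) : ℝ) - 1 = m := by push_cast; ring
  have hwc : HasCompactSupport fun z => v (x + z) :=
    hvc.comp_homeomorph (Homeomorph.addLeft x)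
  rw [sphereAvg, hd]
  refine setAverage_sphere_eq_rotAvg (by fun_prop) hwc
    (fun g => g.toIsometryEquiv.measurePreserving_hausdorffMeasure _) y
    (hausdorffMeasure_sphere_pos m (norm_pos_iff.2 hy)).ne'
    (hausdorffMeasure_sphere_lt_top m (norm_pos_iff.2 hy)).ne

/-- The integral of a radial function against `v` reduces to the deviation of the spherical means
of `v` when the radial function has total integral zero. -/
lemma abs_integral_radial_mul_le {m : ℕ} {ψ v : EuclideanSpace ℝ (Fin (m + 1)) → ℝ}
    (hψ : Continuous ψ) (hψrad : ∀ y z, ‖y‖ = ‖z‖ → ψ y = ψ z) {h : ℝ}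
    (hψsupp : ∀ y, ψ y ≠ 0 → ‖y‖ ≤ h) (hψ0 : ∫ y, ψ y = 0)
    (hv : Continuous v) (hvc : HasCompactSupport v) (x : EuclideanSpace ℝ (Fin (m + 1)))
    {B : ℝ} (hB0 : 0 ≤ B)
    (hB : ∀ s, 0 < s → s ≤ h → |sphereAvg (m + 1) v x s - v x| ≤ B) :
    |∫ y, ψ y * v (x - y)| ≤ (∫ y, |ψ y|) * B := by
  have hψc : HasCompactSupport ψ :=
    HasCompactSupport.intro (isCompact_closedBall 0 h) fun y hy => by
      by_contra h'
      exact hy (by simpa using hψsupp y h')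
  have hψi : Integrable ψ := hψ.integrable_of_hasCompactSupport hψc
  have hflip : ∫ y, ψ y * v (x - y) = ∫ y, ψ y * v (x + y) := by
    rw [← integral_neg_eq_self]
    refine integral_congr_ae (.of_forall fun y => ?_)
    simp only [sub_neg_eq_add]
    rw [hψrad (-y) y (norm_neg y)]
  have hsub : ∫ y, ψ y * v (x + y) = ∫ y, ψ y * (v (x + y) - v x) := by
    have hi : Integrable fun y => ψ y * v (x + y) :=
      Continuous.integrable_of_hasCompactSupport (by fun_prop) hψc.mul_right
    simp_rw [mul_sub]
    rw [integral_sub hi (hψi.mul_const _), integral_mul_const, hψ0, zero_mul, sub_zero]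
  have hrot : ∫ y, ψ y * (v (x + y) - v x) =
      ∫ y, ψ y * (rotAvg (fun z => v (x + z)) y - v x) := by
    rw [← integral_rotAvg (w := fun y => ψ y * (v (x + y) - v x)) (by fun_prop) hψc.mul_right
      fun g => g.measurePreserving]
    refine integral_congr_ae (.of_forall fun y => ?_)
    have h1 := rotAvg_mul_of_radial hψrad (fun y => v (x + y) - v x) y
    have h2 := rotAvg_sub_const (w := fun z => v (x + z)) (by fun_prop) (v x) y
    simp only [h1, h2]
  rw [hflip, hsub, hrot, ← integral_mul_const, ← Real.norm_eq_abs]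
  refine norm_integral_le_of_norm_le (hψi.abs.mul_const B) (.of_forall fun y => ?_)
  rw [norm_mul, Real.norm_eq_abs, Real.norm_eq_abs]
  by_cases hψy : ψ y = 0
  · simp [hψy]
  gcongr
  by_cases hy : y = 0
  · simpa [hy, rotAvg_zero] using hB0
  · rw [← sphereAvg_norm_eq_rotAvg hv hvc x hy]
    exact hB _ (norm_pos_iff.2 hy) (hψsupp y hψy)

lemma integral_abs_lapl_rescale {ρ : EuclideanSpace ℝ (Fin n) → ℝ} (hρ : ContDiff ℝ 2 ρ) {h : ℝ}
    (hh : 0 < h) :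
    ∫ y, |lapl n (fun y => (h ^ n)⁻¹ * ρ (h⁻¹ • y)) y| = (h ^ 2)⁻¹ * ∫ y, |lapl n ρ y| := by
  simp_rw [lapl_const_mul_comp_smul ρ hρ, abs_mul]
  rw [integral_const_mul, Measure.integral_comp_inv_smul volume (fun y => |lapl n ρ y|)]
  rw [finrank_euclideanSpace_fin, smul_eq_mul, abs_of_pos (pow_pos hh n),
    abs_of_pos (by positivity), abs_of_pos (by positivity)]
  field_simp

lemma abs_lapl_moll_le {m : ℕ} {ρ v : EuclideanSpace ℝ (Fin (m + 1)) → ℝ}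
    (hρ : ContDiff ℝ 2 ρ) (hρsupp : Function.support ρ ⊆ closedBall 0 1)
    (hρrad : ∀ x y, ‖x‖ = ‖y‖ → ρ x = ρ y) (hv : Continuous v) (hvc : HasCompactSupport v)
    {h : ℝ} (hh : 0 < h) (x : EuclideanSpace ℝ (Fin (m + 1))) {B : ℝ} (hB0 : 0 ≤ B)
    (hB : ∀ s, 0 < s → s ≤ h → |sphereAvg (m + 1) v x s - v x| ≤ B) :
    |lapl (m + 1) (moll (m + 1) ρ v h) x| ≤ (h ^ 2)⁻¹ * (∫ y, |lapl (m + 1) ρ y|) * B := by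
  set φ : EuclideanSpace ℝ (Fin (m + 1)) → ℝ := fun y => (h ^ (m + 1))⁻¹ * ρ (h⁻¹ • y) with hφ_def
  have hφ : ContDiff ℝ 2 φ := contDiff_const.mul (hρ.comp (contDiff_const_smul _))
  have hφsupp : tsupport φ ⊆ closedBall 0 h := by
    refine closure_minimal (fun y hy => ?_) isClosed_closedBall
    have h1 : h⁻¹ • y ∈ closedBall (0 : EuclideanSpace ℝ (Fin (m + 1))) 1 :=
      hρsupp (right_ne_zero_of_mul hy)
    rw [mem_closedBall_zero_iff, norm_smul, norm_inv, Real.norm_of_nonneg hh.le,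
      inv_mul_le_iff₀ hh, mul_one] at h1
    simpa using h1
  have hφc : HasCompactSupport φ :=
    (isCompact_closedBall 0 h).of_isClosed_subset (isClosed_tsupport φ) hφsupp
  have hφrad (y z : EuclideanSpace ℝ (Fin (m + 1))) (hyz : ‖y‖ = ‖z‖) : φ y = φ z := by
    simp only [hφ_def]
    rw [hρrad (h⁻¹ • y) (h⁻¹ • z) (by rw [norm_smul, norm_smul, hyz])]
  have hlapl : lapl (m + 1) (moll (m + 1) ρ v h) x = ∫ y, lapl (m + 1) φ y * v (x - y) :=
    lapl_convolution_mul hφ hφc hv.locallyIntegrable x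
  rw [hlapl, ← integral_abs_lapl_rescale hρ hh]
  refine abs_integral_radial_mul_le hφ.continuous_lapl (fun y z => hφ.lapl_radial hφrad)
    (fun y hy => ?_) (integral_lapl_eq_zero hφ hφc) hv hvc x hB0 hB
  by_contra hlt
  exact hy (lapl_eq_zero_of_notMem_tsupport fun hmem => hlt (by simpa using hφsupp hmem))

lemma exists_continuous_hasCompactSupport_eqOn_closedBall {v : EuclideanSpace ℝ (Fin n) → ℝ}
    {a R : ℝ} (ha : 0 < a) (haR : a < R) (hv : ContinuousOn v (ball 0 R)) :
    ∃ u : EuclideanSpace ℝ (Fin n) → ℝ,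
      Continuous u ∧ HasCompactSupport u ∧ EqOn u v (closedBall 0 a) := by
  obtain ⟨b, hab, hbR⟩ := exists_between haR
  let χ : ContDiffBump (0 : EuclideanSpace ℝ (Fin n)) := ⟨a, b, ha, hab⟩
  refine ⟨fun y => χ y * v y, ?_, χ.hasCompactSupport.mul_right, fun y hy => ?_⟩
  · refine continuous_of_tsupport fun y hy => ?_
    have hy' : y ∈ closedBall 0 b := by
      simpa only [χ.tsupport_eq] using tsupport_mul_subset_left hy
    exact χ.continuous.continuousAt.mul
      (hv.continuousAt (isOpen_ball.mem_nhds (closedBall_subset_ball hbR hy')))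
  · simp [χ.one_of_mem_closedBall hy]

lemma sphereAvg_congr {u v : EuclideanSpace ℝ (Fin n) → ℝ} {a s : ℝ}
    {x : EuclideanSpace ℝ (Fin n)} (huv : EqOn u v (closedBall 0 a)) (hxs : ‖x‖ + s ≤ a) :
    sphereAvg n u x s = sphereAvg n v x s := by
  refine setAverage_congr_fun isClosed_sphere.measurableSet (.of_forall fun y hy => huv ?_)
  rw [mem_closedBall_zero_iff]
  rw [mem_sphere_zero_iff_norm] at hy
  linarith [norm_add_le x y]

lemma moll_congr {ρ u v : EuclideanSpace ℝ (Fin n) → ℝ}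
    (hρsupp : Function.support ρ ⊆ closedBall 0 1) {a h : ℝ} (hh : 0 < h)
    {x : EuclideanSpace ℝ (Fin n)} (huv : EqOn u v (closedBall 0 a)) (hxh : ‖x‖ + h ≤ a) :
    moll n ρ u h x = moll n ρ v h x := by
  refine integral_congr_ae (.of_forall fun y => ?_)
  by_cases hy : ρ (h⁻¹ • y) = 0
  · simp [hy]
  have h1 := hρsupp hy
  rw [mem_closedBall_zero_iff, norm_smul, norm_inv, Real.norm_of_nonneg hh.le,
    inv_mul_le_iff₀ hh, mul_one] at h1
  have h2 : x - y ∈ closedBall (0 : EuclideanSpace ℝ (Fin n)) a := by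
    rw [mem_closedBall_zero_iff]
    linarith [norm_sub_le x y]
  simp only [huv h2]

end

/-- **Laplacian mollification estimate** (inequality (3.31), second part).
Let `r ≥ t > 0`, `α ∈ (0,1)`, `v ∈ C(B_{r+t}(0))` in `ℝⁿ`, and suppose
`|⨍_{∂B_h(0)} v(x+y) dσ_y - v(x)| ≤ A h^{1+α}` for all `x ∈ B_r(0)`, `h ∈ (0,t]`.
Let `ρ` be smooth, nonnegative, radially symmetric, supported in the closed unit
ball, with `∫ρ = 1`, and let `v_h = ρ_h * v` with `ρ_h(x) = h⁻ⁿρ(x/h)`. Then there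
is `C = C(n,ρ)` with `|Δv_h(x)| ≤ C A h^{α-1}` for all `h ∈ (0,t]`, `x ∈ B_r(0)`. -/
theorem mollification_laplacian_estimate (n : ℕ) (ρ : EuclideanSpace ℝ (Fin n) → ℝ)
    (hρ_smooth : ContDiff ℝ (⊤ : ℕ∞) ρ) (hρ_nonneg : ∀ x, 0 ≤ ρ x)
    (hρ_supp : Function.support ρ ⊆ closedBall 0 1)
    (hρ_int : ∫ x : EuclideanSpace ℝ (Fin n), ρ x = 1)
    (hρ_radial : ∀ x y : EuclideanSpace ℝ (Fin n), ‖x‖ = ‖y‖ → ρ x = ρ y) :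
    ∃ C : ℝ, ∀ r t α : ℝ, 0 < t → t ≤ r → 0 < α → α < 1 →
      ∀ v : EuclideanSpace ℝ (Fin n) → ℝ, ∀ A : ℝ, 0 ≤ A →
      ContinuousOn v (ball 0 (r + t)) →
      (∀ x ∈ ball (0 : EuclideanSpace ℝ (Fin n)) r, ∀ h : ℝ, 0 < h → h ≤ t →
        |sphereAvg n v x h - v x| ≤ A * h ^ (1 + α)) →
      ∀ h : ℝ, 0 < h → h ≤ t →
      ∀ x ∈ ball (0 : EuclideanSpace ℝ (Fin n)) r,
        |lapl n (moll n ρ v h) x| ≤ C * A * h ^ (α - 1) := by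
  have hρ : ContDiff ℝ 2 ρ := hρ_smooth.of_le (WithTop.coe_le_coe.2 le_top)
  refine ⟨∫ y, |lapl n ρ y|, ?_⟩
  intro r t α ht htr hα hα1 v A hA hv hmean h hh hht x hx
  obtain _ | m := n
  · simp [lapl]
  rw [mem_ball_zero_iff] at hx
  obtain ⟨d, hxd, hdr⟩ := exists_between hx
  have hd : 0 ≤ d := (norm_nonneg x).trans hxd.le
  obtain ⟨u, hu, huc, huv⟩ := exists_continuous_hasCompactSupport_eqOn_closedBall
    (a := d + t) (by linarith) (by linarith) hv
  have hmoll : moll (m + 1) ρ v h =ᶠ[nhds x] moll (m + 1) ρ u h := by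
    filter_upwards [isOpen_ball.mem_nhds (mem_ball_zero_iff.2 hxd)] with z hz
    rw [mem_ball_zero_iff] at hz
    exact (moll_congr hρ_supp hh huv (by linarith)).symm
  rw [lapl_congr hmoll]
  refine (abs_lapl_moll_le hρ hρ_supp hρ_radial hu huc hh x (B := A * h ^ (1 + α))
    (by positivity) fun s hs hsh => ?_).trans_eq ?_
  · rw [sphereAvg_congr huv (by linarith), huv (mem_closedBall_zero_iff.2 (by linarith))]
    refine (hmean x (mem_ball_zero_iff.2 hx) s hs (hsh.trans hht)).trans ?_
    gcongr
  · have hpow : (h ^ 2)⁻¹ * h ^ (1 + α) = h ^ (α - 1) := by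
      rw [← Real.rpow_natCast, ← Real.rpow_neg hh.le, ← Real.rpow_add hh]
      congr 1
      push_cast
      ring
    rw [← hpow]
    ring
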